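/- Fix integers $N \ge 1$, $M \ge 1$ and let $L = \Lambda^N + u_{N-1}\Lambda^{N-1} + \cdots + u_{-M}\Lambda^{-M}$. Let $X, Y$ be twisted series with support bounded above satisfying $[X, L] = 0$ and $[Y, L] = 0$. Then both $\mathrm{res}\big(X\,[Y_+, L]\big)$ and $\mathrm{res}\big(X\,[L, (LY)_-]\big)$ lie in the additive subgroup $(\sigma - \mathrm{id})(R)$ of $R$. (Hence the two Poisson brackets of any two functionals whose differentials commute with $L$ vanish: such Hamiltonians are in involution with respect to both Hamiltonian structures.) -/

import Mathlib

/-!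
STATEMENT 12.  Fix `N, M ≥ 1`, let `L = Λ^N + u_{N-1}Λ^{N-1} + ⋯ + u_{-M}Λ^{-M}`,
and let `X, Y` be twisted series with support bounded above with `[X,L] = 0` and
`[Y,L] = 0`.  Then `res(X [Y₊, L])` and `res(X [L, (LY)₋])` both lie in the additive
subgroup `(σ - id)(R)`: the two Poisson brackets of functionals whose differentials
commute with `L` vanish, i.e. such Hamiltonians are in involution with respect to
both Hamiltonian structures.
-/

open scoped BigOperators

namespace Toda

variable {R : Type*} [CommRing R]

/-- Twisted product of series `A = ∑ a_k Λ^k`, `B = ∑ b_k Λ^k` over `(R,σ)`: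
`(A B)_k = ∑_{i+j=k} a_i σ^i(b_j)` (a finite sum when supports are bounded). -/
noncomputable def tmul (σ : R ≃+* R) (a b : ℤ → R) : ℤ → R :=
  fun k => ∑ᶠ i : ℤ, a i * (σ ^ i) (b (k - i))

/-- Commutator `[A,B] = AB - BA`. -/
noncomputable def tcomm (σ : R ≃+* R) (a b : ℤ → R) : ℤ → R :=
  tmul σ a b - tmul σ b a

/-- `A₊`: the part of nonnegative degree. -/
def tpos (a : ℤ → R) : ℤ → R := fun k => if 0 ≤ k then a k else 0

/-- `A₋`: the part of negative degree. -/
def tneg (a : ℤ → R) : ℤ → R := fun k => if k < 0 then a k else 0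

/-- The part of degree `≤ 0`. -/
def tle0 (a : ℤ → R) : ℤ → R := fun k => if k ≤ 0 then a k else 0

/-- The part of degree `> 0`. -/
def tgt0 (a : ℤ → R) : ℤ → R := fun k => if 0 < k then a k else 0

/-- The monomial `Λ^m` (coefficient `1` in degree `m`). -/
def tunit (m : ℤ) : ℤ → R := fun k => if k = m then 1 else 0

/-- `n`-th power for the twisted product. -/
noncomputable def tnpow (σ : R ≃+* R) (a : ℤ → R) : ℕ → (ℤ → R)
  | 0 => tunit 0
  | n + 1 => tmul σ a (tnpow σ a n)

/-- The residue `res A = a_0`. -/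
def tres (a : ℤ → R) : R := a 0

/-- `A` has support bounded above. -/
def SuppBddAbove (a : ℤ → R) : Prop := ∃ B : ℤ, ∀ k : ℤ, B < k → a k = 0

end Toda

open Toda

namespace Toda

section

variable {R : Type*} [CommRing R] (σ : R ≃+* R)

lemma tmul_eq_sum {a b : ℤ → R} {A B : ℤ} (ha : ∀ k, A < k → a k = 0)
    (hb : ∀ k, B < k → b k = 0) (k : ℤ) :
    tmul σ a b k = ∑ i ∈ Finset.Icc (k - B) A, a i * (σ ^ i) (b (k - i)) := by
  refine finsum_eq_sum_of_support_subset _ fun i hi => ?_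
  rw [Finset.coe_Icc, Set.mem_Icc]
  by_contra h
  rw [not_and_or, not_le, not_le] at h
  refine hi ?_
  rcases h with h | h
  · simp [hb (k - i) (by lia)]
  · simp [ha i h]

lemma tmul_eq_zero_of_lt {a b : ℤ → R} {A B : ℤ} (ha : ∀ k, A < k → a k = 0)
    (hb : ∀ k, B < k → b k = 0) (k : ℤ) (hk : A + B < k) : tmul σ a b k = 0 := by
  rw [tmul_eq_sum σ ha hb, Finset.Icc_eq_empty (by lia), Finset.sum_empty]

lemma SuppBddAbove.tmul {a b : ℤ → R} (ha : SuppBddAbove a) (hb : SuppBddAbove b) :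
    SuppBddAbove (tmul σ a b) := by
  obtain ⟨A, ha⟩ := ha
  obtain ⟨B, hb⟩ := hb
  exact ⟨A + B, tmul_eq_zero_of_lt σ ha hb⟩

lemma SuppBddAbove.tpos {a : ℤ → R} (ha : SuppBddAbove a) : SuppBddAbove (tpos a) := by
  obtain ⟨A, ha⟩ := ha
  exact ⟨A, fun k hk => by simp [Toda.tpos, ha k hk]⟩

lemma suppBddAbove_tneg (a : ℤ → R) : SuppBddAbove (tneg a) :=
  ⟨0, fun k hk => by simp [tneg, hk.le]⟩

lemma tmul_assoc {a b c : ℤ → R} (ha : SuppBddAbove a) (hb : SuppBddAbove b)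
    (hc : SuppBddAbove c) : tmul σ (tmul σ a b) c = tmul σ a (tmul σ b c) := by
  obtain ⟨A, ha⟩ := ha
  obtain ⟨B, hb⟩ := hb
  obtain ⟨C, hc⟩ := hc
  funext k
  rw [tmul_eq_sum σ (tmul_eq_zero_of_lt σ ha hb) hc,
    tmul_eq_sum σ ha (tmul_eq_zero_of_lt σ hb hc)]
  simp only [tmul_eq_sum σ ha hb, tmul_eq_sum σ hb hc, map_sum, Finset.mul_sum, Finset.sum_mul]
  rw [Finset.sum_sigma', Finset.sum_sigma']
  refine Finset.sum_bij' (fun x _ => ⟨x.2, x.1 - x.2⟩) (fun x _ => ⟨x.1 + x.2, x.1⟩)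
    ?_ ?_ ?_ ?_ ?_
  · rintro ⟨m, i⟩ h
    simp only [Finset.mem_sigma, Finset.mem_Icc] at h ⊢
    lia
  · rintro ⟨i, j⟩ h
    simp only [Finset.mem_sigma, Finset.mem_Icc] at h ⊢
    lia
  · rintro ⟨m, i⟩ -
    simp
  · rintro ⟨i, j⟩ -
    simp
  · rintro ⟨m, i⟩ -
    have hσ : (σ ^ m) (c (k - m)) = (σ ^ i) ((σ ^ (m - i)) (c (k - m))) := by
      rw [← RingAut.mul_apply, ← zpow_add, add_sub_cancel]
    simp only [map_mul, hσ, mul_assoc, sub_sub, add_sub_cancel]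

lemma tmul_sub {a b c : ℤ → R} (ha : SuppBddAbove a) (hb : SuppBddAbove b)
    (hc : SuppBddAbove c) : tmul σ a (b - c) = tmul σ a b - tmul σ a c := by
  obtain ⟨A, ha⟩ := ha
  obtain ⟨B, hb⟩ := hb
  obtain ⟨C, hc⟩ := hc
  have hb' : ∀ k, max B C < k → b k = 0 := fun k hk => hb k (by lia)
  have hc' : ∀ k, max B C < k → c k = 0 := fun k hk => hc k (by lia)
  have hbc : ∀ k, max B C < k → (b - c) k = 0 := fun k hk => by simp [hb' k hk, hc' k hk]
  funext k
  rw [Pi.sub_apply, tmul_eq_sum σ ha hbc, tmul_eq_sum σ ha hb', tmul_eq_sum σ ha hc',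
    ← Finset.sum_sub_distrib]
  simp only [Pi.sub_apply, map_sub, mul_sub]

/-- The additive subgroup `(σ - id)(R)`. -/
def coboundaries : AddSubgroup R :=
  ((σ : R →+* R).toAddMonoidHom - AddMonoidHom.id R).range

lemma mem_coboundaries {x : R} : x ∈ coboundaries σ ↔ ∃ r : R, x = σ r - r := by
  simp [coboundaries, AddMonoidHom.mem_range, eq_comm]

lemma zpow_apply_sub_mem_coboundaries (n : ℤ) (x : R) :
    (σ ^ n) x - x ∈ coboundaries σ := by
  have step (m : ℤ) : (σ ^ (m + 1)) x - (σ ^ m) x ∈ coboundaries σ :=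
    (mem_coboundaries σ).2 ⟨(σ ^ m) x, by rw [add_comm, zpow_add, zpow_one, RingAut.mul_apply]⟩
  induction n with
  | zero => simp
  | succ m ih => simpa using add_mem (step m) ih
  | pred m ih => simpa using sub_mem ih (step (-m - 1))

/-- The residue is a trace modulo `(σ - id)(R)`. -/
lemma tres_tcomm_mem_coboundaries {a b : ℤ → R} (ha : SuppBddAbove a) (hb : SuppBddAbove b) :
    tres (tcomm σ a b) ∈ coboundaries σ := by
  obtain ⟨A, ha⟩ := ha
  obtain ⟨B, hb⟩ := hb
  have hba : tmul σ b a 0 = ∑ i ∈ Finset.Icc (0 - B) A, b (-i) * (σ ^ (-i)) (a i) := by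
    rw [tmul_eq_sum σ hb ha]
    refine Finset.sum_bij' (fun i _ => -i) (fun i _ => -i) ?_ ?_ ?_ ?_ ?_ <;> intro i hi
    · simp only [Finset.mem_Icc] at hi ⊢
      lia
    · simp only [Finset.mem_Icc] at hi ⊢
      lia
    · simp
    · simp
    · simp
  rw [tres, tcomm, Pi.sub_apply, hba, tmul_eq_sum σ ha hb, ← Finset.sum_sub_distrib]
  refine sum_mem fun i _ => ?_
  have h := zpow_apply_sub_mem_coboundaries σ i (b (-i) * (σ ^ (-i)) (a i))
  rw [zero_sub]
  rwa [map_mul, ← RingAut.mul_apply, ← zpow_add, add_neg_cancel, zpow_zero, RingAut.one_apply,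
    mul_comm ((σ ^ i) _)] at h

/-- Left multiplication by a series commuting with `l` is compatible with `[·, l]`. -/
lemma tmul_tcomm_of_commute {x a l : ℤ → R} (hx : SuppBddAbove x) (ha : SuppBddAbove a)
    (hl : SuppBddAbove l) (hxl : tcomm σ x l = 0) :
    tmul σ x (tcomm σ a l) = tcomm σ (tmul σ x a) l := by
  rw [tcomm, tcomm, tmul_sub σ hx (ha.tmul σ hl) (hl.tmul σ ha), tmul_assoc σ hx ha hl,
    ← tmul_assoc σ hx hl ha, ← tmul_assoc σ hl hx ha, sub_eq_zero.1 hxl]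

lemma tmul_tcomm_of_commute' {x a l : ℤ → R} (hx : SuppBddAbove x) (ha : SuppBddAbove a)
    (hl : SuppBddAbove l) (hxl : tcomm σ x l = 0) :
    tmul σ x (tcomm σ l a) = tcomm σ l (tmul σ x a) := by
  rw [tcomm, tcomm, tmul_sub σ hx (hl.tmul σ ha) (ha.tmul σ hl), tmul_assoc σ hx ha hl,
    ← tmul_assoc σ hx hl ha, ← tmul_assoc σ hl hx ha, sub_eq_zero.1 hxl]

end

end Toda

/-- **Involutivity of the Hamiltonians**: if `[X,L] = 0 = [Y,L]` then
`res(X·[Y₊,L]) ∈ (σ-id)(R)` and `res(X·[L,(LY)₋]) ∈ (σ-id)(R)`. -/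
theorem hamiltonians_in_involution {R : Type*} [CommRing R] (σ : R ≃+* R)
    (N M : ℕ) (hN : 1 ≤ N) (hM : 1 ≤ M) (L X Y : ℤ → R)
    (hLtop : L (N : ℤ) = 1)
    (hLhigh : ∀ k : ℤ, (N : ℤ) < k → L k = 0)
    (hLlow : ∀ k : ℤ, k < -(M : ℤ) → L k = 0)
    (hX : SuppBddAbove X) (hY : SuppBddAbove Y)
    (hXL : tcomm σ X L = 0) (hYL : tcomm σ Y L = 0) :
    (∃ r : R, tres (tmul σ X (tcomm σ (tpos Y) L)) = σ r - r) ∧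
    (∃ r : R, tres (tmul σ X (tcomm σ L (tneg (tmul σ L Y)))) = σ r - r) := by
  have hL : SuppBddAbove L := ⟨N, hLhigh⟩
  have hYp : SuppBddAbove (tpos Y) := hY.tpos
  have hLY : SuppBddAbove (tneg (tmul σ L Y)) := suppBddAbove_tneg _
  rw [← mem_coboundaries, ← mem_coboundaries, tmul_tcomm_of_commute σ hX hYp hL hXL,
    tmul_tcomm_of_commute' σ hX hLY hL hXL]
  exact ⟨tres_tcomm_mem_coboundaries σ (hX.tmul σ hYp) hL,
    tres_tcomm_mem_coboundaries σ hL (hX.tmul σ hLY)⟩
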